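/- Let k ≥ 4 and let w be a word over Σ = {a,b}. If p, q ∈ {u, v} are two consecutive occurrences in w with p occurring before q, and F_p, F_q are their sets of forbidden positions, then |F_p| ≤ |F_q| + 1. -/

import Mathlib

namespace Restivo

/-- Words over the two-letter alphabet Σ = {a, b}, encoded as lists of booleans. -/
abbrev Word := List Bool

/-- The letter `a`. -/
def a : Bool := false

/-- The letter `b`. -/
def b : Bool := true

/-- Kleene star: all finite concatenations of words from `S` (including the empty word). -/
def kstar (S : Set Word) : Set Word :=
  { w | ∃ L : List Word, (∀ x ∈ L, x ∈ S) ∧ L.flatten = w }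

/-- Prefixes of words of `L`. -/
def Pref (L : Set Word) : Set Word := { w | ∃ z : Word, w ++ z ∈ L }

/-- Factors (contiguous subwords) of words of `L`. -/
def Facts (L : Set Word) : Set Word := { w | ∃ x y : Word, x ++ w ++ y ∈ L }

/-- The word u = b a^(k-1). -/
def u (k : ℕ) : Word := b :: List.replicate (k - 1) a

/-- The word v = b^(k-1) a. -/
def v (k : ℕ) : Word := List.replicate (k - 1) b ++ [a]

/-- The set S_k = (Σ^k \ {u, v}) ∪ (Σ^(k-1) \ {a^(k-1), b^(k-1)}). -/
def Sk (k : ℕ) : Set Word :=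
  { w | w.length = k ∧ w ≠ u k ∧ w ≠ v k } ∪
  { w | w.length = k - 1 ∧ w ≠ List.replicate (k - 1) a ∧ w ≠ List.replicate (k - 1) b }

/-- Position `j` is forbidden in `w` w.r.t. `S` if the suffix of `w` starting from
position `j` is not a prefix of any word of `S*`. -/
def Forbidden (S : Set Word) (w : Word) (j : ℕ) : Prop :=
  w.drop j ∉ Pref (kstar S)

/-- The word `p` occurs in `w` at position `s`. -/
def OccursAt (p w : Word) (s : ℕ) : Prop :=
  s + p.length ≤ w.length ∧ (w.drop s).take p.length = p

/-- The set of (locally enumerated) forbidden positions of the occurrence of `p`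
at position `s` in `w`, with respect to `S_k`. -/
def Focc (k : ℕ) (w p : Word) (s : ℕ) : Set ℕ :=
  { i | i < p.length ∧ Forbidden (Sk k) w (s + i) }

/-- Two occurrences (of words from {u, v}) at positions `s < t` in `w` are
consecutive: no word from {u, v} occurs at a position strictly between them. -/
def Consecutive (k : ℕ) (w : Word) (s t : ℕ) : Prop :=
  s < t ∧ ∀ m, s < m → m < t → ¬ OccursAt (u k) w m ∧ ¬ OccursAt (v k) w m

/-- `w` is a minimal uncompletable word for `S`. -/
def MinUncompletable (S : Set Word) (w : Word) : Prop :=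
  w ∉ Facts (kstar S) ∧ ∀ w' : Word, w' ∉ Facts (kstar S) → w.length ≤ w'.length

theorem length_u {k : ℕ} (hk : 1 ≤ k) : (u k).length = k := by
  simp [u]; omega

theorem length_v {k : ℕ} (hk : 1 ≤ k) : (v k).length = k := by
  simp [v]; omega

theorem append_mem_Pref_kstar {S : Set Word} {x y : Word} (hx : x ∈ S)
    (hy : y ∈ Pref (kstar S)) : x ++ y ∈ Pref (kstar S) := by
  obtain ⟨z, L, hL, hz⟩ := hy
  exact ⟨z, x :: L, by simpa using ⟨hx, hL⟩, by simp [hz]⟩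

theorem append_replicate_b_ne_u {k : ℕ} (hk : 2 ≤ k) (r : Word) (m : ℕ) :
    r ++ List.replicate (m + 1) b ≠ u k := by
  obtain ⟨n, rfl⟩ := Nat.exists_eq_add_of_le' hk
  intro h
  have := congrArg List.getLast? h
  simp [u, List.replicate_succ', a, b, List.getLast?_cons] at this

theorem append_replicate_b_ne_v (k : ℕ) (r : Word) (m : ℕ) :
    r ++ List.replicate (m + 1) b ≠ v k := by
  intro h
  have := congrArg List.getLast? h
  simp [v, List.replicate_succ', a, b] at this

/-- A word shorter than `k` can be padded with the letter `b`, as both `u` and `v` end in `a`. -/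
theorem mem_Pref_kstar_Sk_of_length_lt {k : ℕ} (hk : 2 ≤ k) {r : Word} (hr : r.length < k) :
    r ∈ Pref (kstar (Sk k)) := by
  obtain ⟨m, hm⟩ := Nat.exists_eq_add_of_lt hr
  refine ⟨List.replicate (m + 1) b, [r ++ List.replicate (m + 1) b], ?_, by simp⟩
  simp only [List.mem_singleton, forall_eq]
  exact Or.inl ⟨by simp; omega, append_replicate_b_ne_u hk r m, append_replicate_b_ne_v k r m⟩

theorem Forbidden.add_of_not_occursAt {k : ℕ} (hk : 2 ≤ k) {w : Word} {j : ℕ}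
    (hj : Forbidden (Sk k) w j) (hu : ¬ OccursAt (u k) w j) (hv : ¬ OccursAt (v k) w j) :
    Forbidden (Sk k) w (j + k) := by
  intro h
  rcases lt_or_ge w.length (j + k) with hlt | hle
  · exact hj (mem_Pref_kstar_Sk_of_length_lt hk (by simp; omega))
  · refine hj ?_
    rw [← List.take_append_drop k (w.drop j), List.drop_drop]
    refine append_mem_Pref_kstar (Or.inl ⟨by simp; omega, fun e => hu ?_, fun e => hv ?_⟩) h
    · simpa [OccursAt, length_u (by omega : 1 ≤ k)] using ⟨hle, e⟩
    · simpa [OccursAt, length_v (by omega : 1 ≤ k)] using ⟨hle, e⟩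

/-- Strictly between consecutive occurrences, forbidden positions propagate by steps of `k`
until they reach the window of the second occurrence. -/
theorem Consecutive.exists_forbidden_window {k : ℕ} (hk : 2 ≤ k) {w : Word} {s t : ℕ}
    (hc : Consecutive k w s t) {j : ℕ} (hsj : s < j) (hjt : j < t + k)
    (hj : Forbidden (Sk k) w j) :
    ∃ i < k, i + t ≡ j [MOD k] ∧ Forbidden (Sk k) w (t + i) := by
  rcases lt_or_ge j t with hlt | hle
  · obtain ⟨hu, hv⟩ := hc.2 j hsj hlt
    obtain ⟨i, hi, hmod, hf⟩ := hc.exists_forbidden_window hk (j := j + k) (by omega) (by omega)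
      (hj.add_of_not_occursAt hk hu hv)
    exact ⟨i, hi, hmod.trans (by simp [Nat.ModEq]), hf⟩
  · exact ⟨j - t, by omega, by rw [Nat.sub_add_cancel hle], by rwa [Nat.add_sub_cancel' hle]⟩
termination_by t + k - j

theorem statement8 (k : ℕ) (hk : 4 ≤ k) (w p q : Word)
    (hp : p = u k ∨ p = v k) (hq : q = u k ∨ q = v k)
    (s t : ℕ) (hop : OccursAt p w s) (hoq : OccursAt q w t)
    (hcons : Consecutive k w s t) :
    (Focc k w p s).ncard ≤ (Focc k w q t).ncard + 1 := by
  have hpk : p.length = k := by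
    rcases hp with rfl | rfl
    exacts [length_u (by omega), length_v (by omega)]
  have hqk : q.length = k := by
    rcases hq with rfl | rfl
    exacts [length_u (by omega), length_v (by omega)]
  have key : ∀ i ∈ Focc k w p s \ {0}, ∃ i' ∈ Focc k w q t, i' + t ≡ s + i [MOD k] := by
    rintro i ⟨⟨hi, hf⟩, h0⟩
    have hpos : 0 < i := Nat.pos_of_ne_zero h0
    have hst := hcons.1
    obtain ⟨i', hi', hmod, hf'⟩ :=
      hcons.exists_forbidden_window (by omega) (j := s + i) (by omega) (by omega) hf
    exact ⟨i', ⟨by omega, hf'⟩, hmod⟩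
  choose! g hg hmod using key
  have hinj : Set.InjOn g (Focc k w p s \ {0}) := by
    intro i hi j hj hij
    have h : s + i ≡ s + j [MOD k] := (hmod i hi).symm.trans (hij ▸ hmod j hj)
    exact (Nat.ModEq.add_left_cancel' s h).eq_of_lt_of_lt (hpk ▸ hi.1.1) (hpk ▸ hj.1.1)
  have hfin : (Focc k w q t).Finite := (Set.finite_lt_nat q.length).subset fun _ hi => hi.1
  calc (Focc k w p s).ncard
      ≤ (Focc k w p s \ {0}).ncard + ({0} : Set ℕ).ncard :=
        Set.ncard_le_ncard_sdiff_add_ncard _ _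
    _ ≤ (Focc k w q t).ncard + 1 := by
        rw [Set.ncard_singleton]
        exact Nat.add_le_add_right (Set.ncard_le_ncard_of_injOn g hg hinj hfin) 1

end Restivo
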